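/- Let M, Σ, V ∈ R^{p×p} be such that I_p − M is invertible and Σ = V + M Σ M^⊤. Then M (I_p − M)^{-1} Σ + Σ + Σ (I_p − M^⊤)^{-1} M^⊤ = (I_p − M)^{-1} V (I_p − M^⊤)^{-1}. -/

import Mathlib

open Matrix

/-- If `I − M` is invertible and `Σ = V + M Σ Mᵀ`, then
`M (I − M)⁻¹ Σ + Σ + Σ (I − Mᵀ)⁻¹ Mᵀ = (I − M)⁻¹ V (I − Mᵀ)⁻¹`. -/
theorem matrix_covariance_identity
    (p : ℕ) (M S V : Matrix (Fin p) (Fin p) ℝ)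
    (hM : IsUnit (1 - M))
    (hS : S = V + M * S * Mᵀ) :
    M * (1 - M)⁻¹ * S + S + S * (1 - Mᵀ)⁻¹ * Mᵀ = (1 - M)⁻¹ * V * (1 - Mᵀ)⁻¹ := by
  have hM' : IsUnit (1 - Mᵀ) := by
    have h : (1 - M)ᵀ = 1 - Mᵀ := by rw [transpose_sub, transpose_one]
    rw [← h]
    rw [isUnit_iff_isUnit_det, det_transpose]
    exact (isUnit_iff_isUnit_det _).mp hM
  rw [isUnit_iff_isUnit_det] at hM hM'
  have hA₁ := mul_nonsing_inv _ hM
  have hA₂ := nonsing_inv_mul _ hM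
  have hB₁ := mul_nonsing_inv _ hM'
  have hB₂ := nonsing_inv_mul _ hM'
  generalize (1 - M)⁻¹ = A at *
  generalize (1 - Mᵀ)⁻¹ = B at *
  have hMA : M * A = A - 1 := by rw [← hA₁]; noncomm_ring
  have hAM : A * M = A - 1 := by rw [← hA₂]; noncomm_ring
  have hMB : Mᵀ * B = B - 1 := by rw [← hB₁]; noncomm_ring
  have hBM : B * Mᵀ = B - 1 := by rw [← hB₂]; noncomm_ring
  have hV : V = S - M * S * Mᵀ := eq_sub_of_add_eq hS.symm
  calc M * A * S + S + S * B * Mᵀ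
      = (A - 1) * S + S + S * (B - 1) := by rw [hMA, mul_assoc S, hBM]
    _ = A * S * B - (A - 1) * S * (B - 1) := by noncomm_ring
    _ = A * S * B - A * M * S * (Mᵀ * B) := by rw [hAM, hMB]
    _ = A * V * B := by rw [hV]; noncomm_ring
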